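/- Let ρ be a Borel probability measure on ℝ^d, Ω ⊆ ℝ^d a bounded set, r_B > 0, δ ∈ (0,1), and N ≥ 1. Let θ_1,…,θ_N be i.i.d. samples from ρ. Define A = {θ_B ∈ Ω : ρ(closed ball of radius r_B centered at θ_B) > (4/N)·((d+1)·log(2N) + log(8/δ))} and B = {θ_B ∈ Ω : min_{1≤i≤N} ‖θ_B − θ_i‖ ≤ r_B}. Then with probability at least 1 − δ (over the i.i.d. samples), A ⊆ B. -/

import Mathlib

open MeasureTheory

noncomputable section

open Classical in
/-- traces of balls on a finite family of points -/
def ballTraces {d : ℕ} {ι : Type} [Fintype ι] (D : Set (EuclideanSpace ℝ (Fin d))) (r : ℝ)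
    (x : ι → EuclideanSpace ℝ (Fin d)) : Finset (Finset ι) :=
  Finset.univ.filter (fun t => ∃ c ∈ D, ∀ j, j ∈ t ↔ x j ∈ Metric.closedBall c r)

theorem geom_choose (n k : ℕ) (hn : 2 ≤ n) : ∑ i ∈ Finset.Iic k, n.choose i ≤ 2 * n ^ k := by
  have h1 : ∑ i ∈ Finset.Iic k, n.choose i ≤ ∑ i ∈ Finset.range (k+1), n ^ i := by
    have : Finset.Iic k = Finset.range (k+1) := by ext; simp
    rw [this]
    exact Finset.sum_le_sum fun i _ => Nat.choose_le_pow n i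
  refine h1.trans ?_
  clear h1
  induction k with
  | zero => simp
  | succ k ih =>
    rw [Finset.sum_range_succ, pow_succ]
    nlinarith [Nat.zero_le (n^k)]

theorem shatter_card {d : ℕ} {ι : Type} [Fintype ι] [DecidableEq ι]
    (D : Set (EuclideanSpace ℝ (Fin d))) (r : ℝ)
    (x : ι → EuclideanSpace ℝ (Fin d)) (s : Finset ι) (hs : (ballTraces D r x).Shatters s) :
    s.card ≤ d + 1 := by
  by_contra! hcard
  have hna : ¬ AffineIndependent ℝ (fun j : s => x j) := by
    intro h
    have h2 := h.card_le_finrank_succ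
    have h3 := Submodule.finrank_le (vectorSpan ℝ (Set.range (fun j : s => x j)))
    simp at h2 h3
    omega
  obtain ⟨I, p, hp1, hp2⟩ := Convex.radon_partition hna
  have key : ∀ t ⊆ s, ∃ c, ∀ j ∈ s, (j ∈ t ↔ ‖x j - c‖ ≤ r) := by
    intro t ht
    obtain ⟨u, hu, rfl⟩ := hs ht
    simp only [ballTraces, Finset.mem_filter, Finset.mem_univ, true_and] at hu
    obtain ⟨c, -, hc⟩ := hu
    refine ⟨c, fun j hj => ?_⟩
    rw [Finset.mem_inter, hc j, mem_closedBall_iff_norm]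
    simp [hj]
  classical
  obtain ⟨c1, h1⟩ := key (s.filter (fun j => ∃ h : j ∈ s, (⟨j, h⟩ : s) ∈ I)) (Finset.filter_subset _ _)
  obtain ⟨c2, h2⟩ := key (s.filter (fun j => ∃ h : j ∈ s, (⟨j, h⟩ : s) ∉ I)) (Finset.filter_subset _ _)
  have hlin : ∀ y, ‖y - c1‖^2 - ‖y - c2‖^2 =
      inner ℝ ((2:ℝ) • (c2 - c1)) y + (‖c1‖^2 - ‖c2‖^2) := by
    intro y
    rw [norm_sub_sq_real, norm_sub_sq_real, inner_smul_left, inner_sub_left,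
      real_inner_comm y c1, real_inner_comm y c2]
    simp; ring
  have hl : IsLinearMap ℝ (fun y => inner ℝ ((2:ℝ) • (c2 - c1)) y) :=
    (innerₗ _ ((2:ℝ) • (c2 - c1))).isLinear
  have e1 : convexHull ℝ ((fun j : s => x j) '' I) ⊆
      {y | inner ℝ ((2:ℝ) • (c2 - c1)) y < -(‖c1‖^2 - ‖c2‖^2)} := by
    refine convexHull_min ?_ (convex_halfSpace_lt hl _)
    rintro _ ⟨⟨j, hj⟩, hjI, rfl⟩
    have a := (h1 j hj).1 (by simp [hj, hjI])
    have b : ¬ ‖x j - c2‖ ≤ r := fun h => by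
      have := (h2 j hj).2 h
      simp [hj, hjI] at this
    have := hlin (x j)
    have := norm_nonneg (x j - c1)
    simp only [Set.mem_ofPred_eq]
    nlinarith
  have e2 : convexHull ℝ ((fun j : s => x j) '' Iᶜ) ⊆
      {y | -(‖c1‖^2 - ‖c2‖^2) < inner ℝ ((2:ℝ) • (c2 - c1)) y} := by
    refine convexHull_min ?_ (convex_halfSpace_gt hl _)
    rintro _ ⟨⟨j, hj⟩, hjI, rfl⟩
    have hjI' : (⟨j, hj⟩ : s) ∉ I := hjI
    have a := (h2 j hj).1 (by simp [hj, hjI'])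
    have b : ¬ ‖x j - c1‖ ≤ r := fun h => by
      have := (h1 j hj).2 h
      simp [hj, hjI'] at this
    have := hlin (x j)
    have := norm_nonneg (x j - c2)
    simp only [Set.mem_ofPred_eq]
    nlinarith
  have q1 := e1 hp1
  have q2 := e2 hp2
  simp only [Set.mem_ofPred_eq] at q1 q2
  exact lt_asymm q1 q2

theorem traces_card {d : ℕ} {ι : Type} [Fintype ι]
    (D : Set (EuclideanSpace ℝ (Fin d))) (r : ℝ)
    (x : ι → EuclideanSpace ℝ (Fin d)) (hι : 2 ≤ Fintype.card ι) :
    (ballTraces D r x).card ≤ 2 * Fintype.card ι ^ (d + 1) := by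
  classical
  have h0 : (ballTraces D r x).vcDim ≤ d + 1 :=
    Finset.sup_le fun s hs => shatter_card D r x s (Finset.mem_shatterer.1 hs)
  refine (Finset.card_le_card_shatterer _).trans
    (Finset.card_shatterer_le_sum_vcDim.trans ((geom_choose _ _ hι).trans ?_))
  gcongr
  omega

/-- symmetrization weight -/
def wt {d : ℕ} (r : ℝ) (c : EuclideanSpace ℝ (Fin d))
    (p : EuclideanSpace ℝ (Fin d) × EuclideanSpace ℝ (Fin d)) : ENNReal :=
  (Metric.closedBall c r)ᶜ.indicator 1 p.1 * (1 + (Metric.closedBall c r).indicator 1 p.2)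

theorem measurable_wt {d : ℕ} (r : ℝ) (c : EuclideanSpace ℝ (Fin d)) : Measurable (wt r c) := by
  have hB : MeasurableSet (Metric.closedBall c r) := Metric.isClosed_closedBall.measurableSet
  unfold wt
  have h1 : Measurable (fun p : EuclideanSpace ℝ (Fin d) × EuclideanSpace ℝ (Fin d) =>
      (Metric.closedBall c r)ᶜ.indicator (1 : EuclideanSpace ℝ (Fin d) → ENNReal) p.1) :=
    (measurable_one.indicator hB.compl).comp measurable_fst
  have h2 : Measurable (fun p : EuclideanSpace ℝ (Fin d) × EuclideanSpace ℝ (Fin d) =>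
      (Metric.closedBall c r).indicator (1 : EuclideanSpace ℝ (Fin d) → ENNReal) p.2) :=
    (measurable_one.indicator hB).comp measurable_snd
  exact h1.mul (h2.const_add 1)

theorem wt_swap {d : ℕ} (r : ℝ) (c : EuclideanSpace ℝ (Fin d))
    (p : EuclideanSpace ℝ (Fin d) × EuclideanSpace ℝ (Fin d)) :
    wt r c p + wt r c p.swap ≤ 2 := by
  unfold wt
  by_cases h1 : p.1 ∈ Metric.closedBall c r <;> by_cases h2 : p.2 ∈ Metric.closedBall c r <;>
    simp only [Set.indicator, Set.mem_compl_iff, h1, h2, Prod.fst_swap, Prod.snd_swap] <;> norm_num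

/-- swap according to a bit -/
def sw {α : Type} (b : Bool) (p : α × α) : α × α := if b then p.swap else p

theorem pointwise {d N : ℕ} (hN : 1 ≤ N) (D : Set (EuclideanSpace ℝ (Fin d))) (r : ℝ)
    (w : Fin N → EuclideanSpace ℝ (Fin d) × EuclideanSpace ℝ (Fin d)) :
    ∑ σ : Fin N → Bool, ⨆ c ∈ D, ∏ i, wt r c (sw (σ i) (w i)) ≤
      2 ^ N * (2 * (2 * N) ^ (d + 1)) := by
  classical
  let x : Fin N × Bool → EuclideanSpace ℝ (Fin d) := fun j => if j.2 then (w j.1).2 else (w j.1).1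
  set A := ballTraces D r x with hA
  have hc : ∀ t : Finset (Fin N × Bool), ∃ c, t ∈ A → c ∈ D ∧
      ∀ j, j ∈ t ↔ x j ∈ Metric.closedBall c r := by
    intro t
    by_cases ht : t ∈ A
    · obtain ⟨c, h⟩ := (Finset.mem_filter.1 ht).2
      exact ⟨c, fun _ => h⟩
    · exact ⟨0, fun h => absurd h ht⟩
  choose C hC using hc
  have hcard : A.card ≤ 2 * (2 * N) ^ (d + 1) := by
    have := traces_card D r x (by simp; omega)
    simpa [mul_comm N 2] using this
  have step : ∀ σ : Fin N → Bool, (⨆ c ∈ D, ∏ i, wt r c (sw (σ i) (w i))) ≤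
      ∑ t ∈ A, ∏ i, wt r (C t) (sw (σ i) (w i)) := by
    intro σ
    refine iSup₂_le fun c hcD => ?_
    let t : Finset (Fin N × Bool) := Finset.univ.filter (fun j => x j ∈ Metric.closedBall c r)
    have ht : t ∈ A := Finset.mem_filter.2 ⟨Finset.mem_univ _, c, hcD, fun j => by simp [t]⟩
    have heq : ∀ j, x j ∈ Metric.closedBall c r ↔ x j ∈ Metric.closedBall (C t) r := fun j => by
      rw [← (hC t ht).2 j]; simp [t]
    have : ∏ i, wt r c (sw (σ i) (w i)) = ∏ i, wt r (C t) (sw (σ i) (w i)) := by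
      refine Finset.prod_congr rfl fun i _ => ?_
      have a : (w i).1 ∈ Metric.closedBall c r ↔ (w i).1 ∈ Metric.closedBall (C t) r := by
        exact heq (i, false)
      have b : (w i).2 ∈ Metric.closedBall c r ↔ (w i).2 ∈ Metric.closedBall (C t) r := by
        exact heq (i, true)
      unfold wt sw
      cases σ i <;> simp only [Set.indicator, Set.mem_compl_iff, Prod.fst_swap, Prod.snd_swap,
        if_true, if_false, a, b, Bool.false_eq_true]
    rw [this]
    exact Finset.single_le_sum (f := fun t => ∏ i, wt r (C t) (sw (σ i) (w i)))
      (fun _ _ => zero_le) ht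
  calc _ ≤ ∑ σ : Fin N → Bool, ∑ t ∈ A, ∏ i, wt r (C t) (sw (σ i) (w i)) :=
        Finset.sum_le_sum fun σ _ => step σ
    _ = ∑ t ∈ A, ∏ i : Fin N, ∑ b : Bool, wt r (C t) (sw b (w i)) := by
        rw [Finset.sum_comm]
        refine Finset.sum_congr rfl fun t _ => ?_
        rw [Finset.prod_univ_sum, Fintype.piFinset_univ]
    _ ≤ ∑ t ∈ A, ∏ i : Fin N, 2 := by
        gcongr with t _ i _
        have := wt_swap r (C t) (w i)
        simpa [sw, add_comm] using this
    _ = A.card * 2 ^ N := by simp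
    _ ≤ _ := by
        rw [mul_comm]
        gcongr
        exact_mod_cast hcard

theorem measurePreserving_sw {α : Type} [MeasurableSpace α] (ρ : Measure α) [SFinite ρ] (b : Bool) :
    MeasurePreserving (sw (α := α) b) (ρ.prod ρ) (ρ.prod ρ) := by
  cases b
  · have : sw (α := α) false = id := by ext <;> simp [sw]
    rw [this]; exact MeasurePreserving.id _
  · have : sw (α := α) true = Prod.swap := by ext <;> simp [sw]
    rw [this]; exact Measure.measurePreserving_swap

theorem integral_upper {d N : ℕ} (hN : 1 ≤ N) (ρ : Measure (EuclideanSpace ℝ (Fin d)))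
    [IsProbabilityMeasure ρ] (D : Set (EuclideanSpace ℝ (Fin d))) (hD : D.Countable) (r : ℝ) :
    ∫⁻ w, (⨆ c ∈ D, ∏ i, wt r c (w i)) ∂(Measure.pi fun _ : Fin N => ρ.prod ρ) ≤
      2 * (2 * N) ^ (d + 1) := by
  set G : (Fin N → EuclideanSpace ℝ (Fin d) × EuclideanSpace ℝ (Fin d)) → ENNReal :=
    fun w => ⨆ c ∈ D, ∏ i, wt r c (w i) with hG
  have hGm : Measurable G := by
    refine Measurable.biSup D hD fun c _ => ?_
    exact Finset.measurable_prod _ fun i _ => (measurable_wt r c).comp (measurable_pi_apply i)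
  have hmp : ∀ σ : Fin N → Bool, MeasurePreserving (fun w i => sw (σ i) (w i))
      (Measure.pi fun _ : Fin N => ρ.prod ρ) (Measure.pi fun _ : Fin N => ρ.prod ρ) := fun σ =>
    measurePreserving_pi _ _ fun i => measurePreserving_sw ρ (σ i)
  have h1 : ∑ σ : Fin N → Bool, ∫⁻ w, G (fun i => sw (σ i) (w i))
      ∂(Measure.pi fun _ : Fin N => ρ.prod ρ) =
      2 ^ N * ∫⁻ w, G w ∂(Measure.pi fun _ : Fin N => ρ.prod ρ) := by
    rw [Finset.sum_congr rfl fun σ _ => (hmp σ).lintegral_comp hGm]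
    simp
  have hsm : ∀ σ : Fin N → Bool, Measurable fun
      w : Fin N → EuclideanSpace ℝ (Fin d) × EuclideanSpace ℝ (Fin d) =>
      G (fun i => sw (σ i) (w i)) := fun σ => hGm.comp (hmp σ).measurable
  rw [← lintegral_finsetSum _ fun σ _ => hsm σ] at h1
  have h2 : 2 ^ N * ∫⁻ w, G w ∂(Measure.pi fun _ : Fin N => ρ.prod ρ) ≤
      2 ^ N * (2 * (2 * N) ^ (d + 1)) := by
    rw [← h1]
    refine (lintegral_mono fun w => pointwise hN D r w).trans ?_
    simp
  exact (ENNReal.mul_le_mul_iff_right (by simp) (by finiteness)).1 h2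

theorem inner_int {d N : ℕ} (ρ : Measure (EuclideanSpace ℝ (Fin d)))
    [IsProbabilityMeasure ρ] (c : EuclideanSpace ℝ (Fin d)) (r : ℝ) :
    ∫⁻ y, ∏ i, (1 + (Metric.closedBall c r).indicator 1 (y i)) ∂(Measure.pi fun _ : Fin N => ρ) =
      (1 + ρ (Metric.closedBall c r)) ^ N := by
  have hB : MeasurableSet (Metric.closedBall c r) := Metric.isClosed_closedBall.measurableSet
  have hm : Measurable (fun y : EuclideanSpace ℝ (Fin d) =>
      (1 : ENNReal) + (Metric.closedBall c r).indicator 1 y) :=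
    (measurable_one.indicator hB).const_add 1
  rw [ProbabilityTheory.lintegral_prod_eq_prod_lintegral_of_indepFun Finset.univ
    (fun i (y : Fin N → EuclideanSpace ℝ (Fin d)) =>
      (1 : ENNReal) + (Metric.closedBall c r).indicator 1 (y i))
    (ProbabilityTheory.iIndepFun_pi (μ := fun _ : Fin N => ρ)
      (X := fun _ y => (1 : ENNReal) + (Metric.closedBall c r).indicator 1 y)
      fun i => hm.aemeasurable)
    (fun i => hm.comp (measurable_pi_apply i))]
  have : ∀ i : Fin N, ∫⁻ y, (1 : ENNReal) + (Metric.closedBall c r).indicator 1 (y i)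
      ∂(Measure.pi fun _ : Fin N => ρ) = 1 + ρ (Metric.closedBall c r) := by
    intro i
    rw [(measurePreserving_eval (fun _ : Fin N => ρ) i).lintegral_comp hm,
      lintegral_add_left measurable_const, lintegral_indicator_one hB]
    simp
  simp [this]

theorem main_bound {d N : ℕ} (hN : 1 ≤ N) (ρ : Measure (EuclideanSpace ℝ (Fin d)))
    [IsProbabilityMeasure ρ] (D : Set (EuclideanSpace ℝ (Fin d))) (hD : D.Countable) (r : ℝ)
    (q : ENNReal) (hq : ∀ c ∈ D, q ≤ ρ (Metric.closedBall c r)) :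
    (1 + q) ^ N * (Measure.pi fun _ : Fin N => ρ)
      (⋃ c ∈ D, {x | ∀ i, x i ∉ Metric.closedBall c r}) ≤ 2 * (2 * N) ^ (d + 1) := by
  refine le_trans ?_ (integral_upper hN ρ D hD r)
  have hGm : Measurable fun w : Fin N → EuclideanSpace ℝ (Fin d) × EuclideanSpace ℝ (Fin d) =>
      ⨆ c ∈ D, ∏ i, wt r c (w i) := by
    refine Measurable.biSup D hD fun c _ => ?_
    exact Finset.measurable_prod _ fun i _ => (measurable_wt r c).comp (measurable_pi_apply i)
  have hmp := (measurePreserving_arrowProdEquivProdArrow (EuclideanSpace ℝ (Fin d))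
    (EuclideanSpace ℝ (Fin d)) (Fin N) (fun _ => ρ) (fun _ => ρ)).symm
  rw [← hmp.lintegral_comp hGm]
  have hcm := hGm.comp hmp.measurable
  simp only [Function.comp_def] at hcm
  rw [lintegral_prod _ hcm.aemeasurable]
  have hbm : MeasurableSet (⋃ c ∈ D, {x : Fin N → EuclideanSpace ℝ (Fin d) |
      ∀ i, x i ∉ Metric.closedBall c r}) := by
    refine MeasurableSet.biUnion hD fun c _ => ?_
    have : {x : Fin N → EuclideanSpace ℝ (Fin d) | ∀ i, x i ∉ Metric.closedBall c r} =
        ⋂ i, (fun x => x i) ⁻¹' (Metric.closedBall c r)ᶜ := by ext; simp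
    rw [this]
    exact MeasurableSet.iInter fun i => measurable_pi_apply i
      Metric.isClosed_closedBall.measurableSet.compl
  rw [← lintegral_indicator_const hbm]
  refine lintegral_mono fun x => ?_
  by_cases hx : x ∈ ⋃ c ∈ D, {x : Fin N → EuclideanSpace ℝ (Fin d) |
      ∀ i, x i ∉ Metric.closedBall c r}
  swap
  · rw [Set.indicator_of_notMem hx]; exact zero_le
  rw [Set.indicator_of_mem hx]
  simp only [Set.mem_iUnion, Set.mem_ofPred_eq] at hx
  obtain ⟨c, hc, hx⟩ := hx
  calc (1 + q) ^ N ≤ (1 + ρ (Metric.closedBall c r)) ^ N := by gcongr; exact hq c hc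
    _ = _ := (inner_int ρ c r).symm
    _ ≤ _ := by
      refine lintegral_mono fun y => ?_
      refine le_trans (le_of_eq ?_) (le_iSup₂ c hc)
      refine Finset.prod_congr rfl fun i _ => ?_
      change _ = wt r c (x i, y i)
      have := hx i
      simp only [wt, Set.indicator, Set.mem_compl_iff, this]
      simp

theorem final_real (d N : ℕ) (hN : 1 ≤ N) (δ ε : ℝ) (h0 : 0 < δ) (h1 : δ < 1)
    (hε : ε = (4 / (N : ℝ)) * (((d : ℝ) + 1) * Real.log (2 * (N : ℝ)) + Real.log (8 / δ)))
    (hε1 : ε ≤ 1) : 0 ≤ ε ∧ 2 * (2 * (N:ℝ)) ^ (d + 1) ≤ (1 + ε) ^ N * δ := by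
  have hN' : (1:ℝ) ≤ N := by exact_mod_cast hN
  have hl1 : 0 ≤ Real.log (2 * (N : ℝ)) := Real.log_nonneg (by linarith)
  have hl2 : 0 ≤ Real.log (8 / δ) := Real.log_nonneg (by rw [le_div_iff₀ h0]; linarith)
  have hε0 : 0 ≤ ε := by rw [hε]; positivity
  refine ⟨hε0, ?_⟩
  have e1 : Real.exp (ε / 4) ≤ 1 + ε := by
    have a := Real.add_one_le_exp (-(ε / 4))
    have b : Real.exp (ε / 4) * Real.exp (-(ε/4)) = 1 := by rw [← Real.exp_add]; simp
    have c := Real.exp_pos (ε / 4)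
    have e : Real.exp (ε / 4) * (1 - ε / 4) ≤ (1 + ε) * (1 - ε / 4) := by nlinarith
    exact le_of_mul_le_mul_right e (by linarith)
  have e2 : Real.exp (ε / 4) ^ N = (2 * (N:ℝ)) ^ (d + 1) * (8 / δ) := by
    rw [← Real.exp_nat_mul]
    have : (N:ℝ) * (ε / 4) = ((d + 1 : ℕ) : ℝ) * Real.log (2 * (N : ℝ)) + Real.log (8 / δ) := by
      rw [hε]; push_cast; field_simp
    rw [this, Real.exp_add, Real.exp_nat_mul, Real.exp_log (by linarith), Real.exp_log (by positivity)]
  have e3 : (2 * (N:ℝ)) ^ (d + 1) * (8 / δ) ≤ (1 + ε) ^ N := by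
    rw [← e2]; gcongr
  calc 2 * (2 * (N:ℝ)) ^ (d + 1) ≤ 8 * (2 * (N:ℝ)) ^ (d + 1) := by gcongr; norm_num
    _ = (2 * (N:ℝ)) ^ (d + 1) * (8 / δ) * δ := by field_simp
    _ ≤ _ := by gcongr

/-- Let `ρ` be a Borel probability measure on `ℝ^d`, `Ω` a bounded
set, `r_B > 0`, `δ ∈ (0,1)` and `N ≥ 1`. For i.i.d. samples `θ₁,…,θ_N ~ ρ`, with
probability at least `1 − δ`, every `θ_B ∈ Ω` whose closed `r_B`-ball has
`ρ`-measure greater than `(4/N)((d+1)log(2N) + log(8/δ))` is within distance `r_B`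
of one of the samples. -/
theorem statement8 {d : ℕ} (ρ : Measure (EuclideanSpace ℝ (Fin d)))
    [IsProbabilityMeasure ρ]
    (Ω : Set (EuclideanSpace ℝ (Fin d))) (hΩ : Bornology.IsBounded Ω)
    (rB δ : ℝ) (hrB : 0 < rB) (hδ : δ ∈ Set.Ioo (0 : ℝ) 1)
    (N : ℕ) (hN : 1 ≤ N) :
    ENNReal.ofReal (1 - δ) ≤
      (Measure.pi fun _ : Fin N => ρ)
        {θs : Fin N → EuclideanSpace ℝ (Fin d) |
          ∀ θB ∈ Ω,
            ENNReal.ofReal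
                ((4 / (N : ℝ)) * (((d : ℝ) + 1) * Real.log (2 * (N : ℝ))
                  + Real.log (8 / δ)))
              < ρ (Metric.closedBall θB rB) →
            ∃ i : Fin N, ‖θB - θs i‖ ≤ rB} := by
  obtain ⟨hδ0, hδ1⟩ := hδ
  set ε := (4 / (N : ℝ)) * (((d : ℝ) + 1) * Real.log (2 * (N : ℝ)) + Real.log (8 / δ)) with hε
  set S := {θs : Fin N → EuclideanSpace ℝ (Fin d) | ∀ θB ∈ Ω,
    ENNReal.ofReal ε < ρ (Metric.closedBall θB rB) → ∃ i : Fin N, ‖θB - θs i‖ ≤ rB} with hS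
  set μ := Measure.pi fun _ : Fin N => ρ with hμ
  set T := {θ | θ ∈ Ω ∧ ENNReal.ofReal ε < ρ (Metric.closedBall θ rB)} with hT
  have hcompl : Sᶜ ⊆ ⋃ c ∈ T, {x | ∀ i, x i ∉ Metric.closedBall c rB} := by
    intro x hx
    simp only [hS, Set.mem_compl_iff, Set.mem_ofPred_eq, not_forall, not_exists] at hx
    obtain ⟨c, hc, hc2, hx⟩ := hx
    simp only [Set.mem_iUnion]
    refine ⟨c, ⟨hc, hc2⟩, fun i hi => hx i ?_⟩
    rwa [mem_closedBall_iff_norm, norm_sub_rev] at hi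
  obtain ⟨D, hDT, hDc, hDeq⟩ := TopologicalSpace.isOpen_biUnion_countable T
    (fun c => {x : Fin N → EuclideanSpace ℝ (Fin d) | ∀ i, x i ∉ Metric.closedBall c rB}) (by
      intro c _
      have : {x : Fin N → EuclideanSpace ℝ (Fin d) | ∀ i, x i ∉ Metric.closedBall c rB} =
        ⋂ i, (fun x => x i) ⁻¹' (Metric.closedBall c rB)ᶜ := by ext; simp
      rw [this]
      exact isOpen_iInter_of_finite fun i =>
        Metric.isClosed_closedBall.isOpen_compl.preimage (continuous_apply i))
  rw [← hDeq] at hcompl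
  have hbad : μ Sᶜ ≤ ENNReal.ofReal δ := by
    refine (measure_mono hcompl).trans ?_
    by_cases hne : D.Nonempty
    · obtain ⟨c, hc⟩ := hne
      have hε1 : ε ≤ 1 := by
        have := (hDT hc).2.le.trans prob_le_one
        exact ENNReal.ofReal_le_one.1 this
      obtain ⟨hε0, hfin⟩ := final_real d N hN δ ε hδ0 hδ1 hε hε1
      have hm := main_bound hN ρ D hDc rB (ENNReal.ofReal ε) (fun c hc => (hDT hc).2.le)
      have hpow : (1 + ENNReal.ofReal ε) ^ N = ENNReal.ofReal ((1 + ε) ^ N) := by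
        rw [ENNReal.ofReal_pow (by linarith), ENNReal.ofReal_add (by norm_num) hε0,
          ENNReal.ofReal_one]
      have hr : (2 * (2 * (N : ENNReal)) ^ (d + 1)) = ENNReal.ofReal (2 * (2 * (N:ℝ)) ^ (d + 1)) := by
        rw [ENNReal.ofReal_mul (by norm_num), ENNReal.ofReal_pow (by positivity),
          ENNReal.ofReal_mul (by norm_num)]
        simp
      rw [hr, hpow] at hm
      have h2 := hm.trans (ENNReal.ofReal_le_ofReal hfin)
      rw [ENNReal.ofReal_mul (by positivity)] at h2
      refine (ENNReal.mul_le_mul_iff_right ?_ (by finiteness)).1 h2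
      have : 0 < (1 + ε) ^ N := by positivity
      simpa using this
    · rw [Set.not_nonempty_iff_eq_empty] at hne
      simp [hne]
  have htot : 1 ≤ μ S + μ Sᶜ := by
    have := measure_union_le (μ := μ) S Sᶜ
    rwa [Set.union_compl_self, measure_univ] at this
  rw [ENNReal.ofReal_sub _ hδ0.le, ENNReal.ofReal_one, tsub_le_iff_right]
  exact htot.trans (by gcongr)
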